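/- Let n ≥ 1, let 0 ≤ k ≤ n, let f : ℝⁿ → ℂ be C^∞, let A_1, …, A_{n−k} and K be convex bodies in ℝⁿ, and let x ∈ ℝⁿ. Then lim_{r → 0⁺} r^{−k} · ∂^{n−k}/∂λ_1⋯∂λ_{n−k} |_{λ=0} ∫_{rK + x + λ_1 A_1 + ⋯ + λ_{n−k} A_{n−k}} f(y) dy = f(x) · ∂^{n−k}/∂λ_1⋯∂λ_{n−k} |_{λ=0} vol(K + λ_1 A_1 + ⋯ + λ_{n−k} A_{n−k}), where vol denotes Lebesgue measure and all mixed partial derivatives at λ = 0 are one-sided (they exist since the integrals are smooth functions of λ ∈ ℝ_{≥0}^{n−k}). -/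

import Mathlib

open scoped Pointwise ContDiff
open MeasureTheory Set Filter

noncomputable section

/-- Euclidean space `ℝⁿ`. -/
abbrev Euc (n : ℕ) := EuclideanSpace ℝ (Fin n)

/-- The one-point convex body `{x}`. -/
def ptBody {n : ℕ} (x : Euc n) : ConvexBody (Euc n) :=
  ⟨{x}, convex_singleton x, isCompact_singleton, Set.singleton_nonempty x⟩

/-- The convex body `t • K + x`. -/
def scaleTrans {n : ℕ} (t : ℝ) (x : Euc n) (K : ConvexBody (Euc n)) : ConvexBody (Euc n) :=
  t • K + ptBody x

/-- One-sided partial derivative in the `i`-th coordinate: the derivative of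
`t ↦ g(λ with i-th coordinate replaced by t)` within `[0, ∞)` (so one-sided at `0`). -/
def pderivOrth {s : ℕ} {F : Type*} [NormedAddCommGroup F] [NormedSpace ℝ F]
    (g : (Fin s → ℝ) → F) (i : Fin s) : (Fin s → ℝ) → F :=
  fun lam => derivWithin (fun t => g (Function.update lam i t)) (Set.Ici 0) (lam i)

/-- The iterated one-sided mixed partial derivative `∂^s/∂λ₁⋯∂λ_s |_{λ=0}` of a function on
the closed orthant `ℝ_{≥0}^s`. -/
def mixedPartialAtZero {s : ℕ} {F : Type*} [NormedAddCommGroup F] [NormedSpace ℝ F]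
    (g : (Fin s → ℝ) → F) : F :=
  (List.foldl pderivOrth g (List.finRange s)) 0

open scoped Topology

universe u

/-! ### Mixed one-sided partial derivatives of smooth functions -/

/-- Iterated one-sided partial derivatives along the closed orthant commute with a linear map
applied after, and with a nonnegative rescaling applied before, a smooth function. -/
theorem exists_contDiff_foldl_pderivOrth {s : ℕ} {P F : Type*} [NormedAddCommGroup P]
    [NormedSpace ℝ P] [NormedAddCommGroup F] [NormedSpace ℝ F] (l : List (Fin s))
    (Ψ : P × (Fin s → ℝ) → F) (hΨ : ContDiff ℝ ∞ Ψ) :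
    ∃ Θ : P × (Fin s → ℝ) → F, ContDiff ℝ ∞ Θ ∧
      ∀ {F' : Type} [NormedAddCommGroup F'] [NormedSpace ℝ F'] (T : F →L[ℝ] F') (p : P) (a : ℝ)
        (g : (Fin s → ℝ) → F'), (∀ lam, 0 ≤ lam → g lam = T (Ψ (p, a • lam))) →
        ∀ lam, 0 ≤ lam → List.foldl pderivOrth g l lam = a ^ l.length • T (Θ (p, a • lam)) := by
  induction l generalizing Ψ with
  | nil => exact ⟨Ψ, hΨ, fun T p a g hg lam hlam => by simpa using hg lam hlam⟩
  | cons i l ih =>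
    obtain ⟨Θ, hΘ, h⟩ := ih (fun q => fderiv ℝ Ψ q (0, Pi.single i 1))
      ((hΨ.fderiv_right (by simp)).clm_apply contDiff_const)
    refine ⟨Θ, hΘ, fun {F'} _ _ T p a g hg lam hlam => ?_⟩
    rw [List.foldl_cons, h (a • T) p a (pderivOrth g i) ?_ lam hlam, List.length_cons, pow_succ,
      mul_smul, smul_apply]
    intro mu hmu
    have hpath : HasDerivAt (fun t : ℝ => (p, a • Function.update mu i t))
        ((0 : P), a • (Pi.single i 1 : Fin s → ℝ)) (mu i) :=
      (hasDerivAt_const _ _).prodMk ((hasDerivAt_update mu i (mu i)).const_smul a)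
    have hd : HasDerivAt (fun t : ℝ => T (Ψ (p, a • Function.update mu i t)))
        (T (fderiv ℝ Ψ (p, a • mu) ((0 : P), a • (Pi.single i 1 : Fin s → ℝ)))) (mu i) := by
      have hΨd := (hΨ.differentiable (by simp) (p, a • mu)).hasFDerivAt
      refine T.hasFDerivAt.comp_hasDerivAt _ (HasFDerivAt.comp_hasDerivAt _ ?_ hpath)
      simpa using hΨd
    have hpos : ∀ t ∈ Ici (0 : ℝ), 0 ≤ Function.update mu i t := fun t ht =>
      le_update_iff.2 ⟨ht, fun j _ => hmu j⟩
    rw [pderivOrth, derivWithin_congr (f := fun t : ℝ => T (Ψ (p, a • Function.update mu i t)))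
      (fun t ht => hg _ (hpos t ht)) (hg _ (hpos _ (hmu i))),
      hd.hasDerivWithinAt.derivWithin (uniqueDiffOn_Ici 0 _ (hmu i))]
    have : ((0 : P), a • (Pi.single i 1 : Fin s → ℝ)) = a • ((0 : P), Pi.single i 1) := by simp
    rw [this, map_smul, map_smul, smul_apply]

/-! ### Smoothness of parametric integrals -/

theorem contDiff_nat_integral_smul_comp {α W : Type*} {E F : Type u} [MeasurableSpace α]
    {μ : Measure α} [NormedAddCommGroup E] [NormedSpace ℝ E] [FiniteDimensional ℝ E]
    [NormedAddCommGroup W] [NormedSpace ℝ W] [NormedAddCommGroup F] [NormedSpace ℝ F]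
    (n : ℕ) {Q : E × W → F} (hQ : ContDiff ℝ ∞ Q) {c : α → ℝ} (hc : Integrable c μ)
    {g : α → W} (hg : AEStronglyMeasurable g μ) {K : Set W} (hK : IsCompact K)
    (hgK : ∀ a, g a ∈ K) :
    ContDiff ℝ n (fun p => ∫ a, c a • Q (p, g a) ∂μ) := by
  have key : ∀ {F : Type u} [NormedAddCommGroup F] [NormedSpace ℝ F] {Q : E × W → F},
      ContDiff ℝ ∞ Q → ∀ p₀, ∃ C, ∀ p ∈ Metric.closedBall p₀ 1, ∀ a, ‖Q (p, g a)‖ ≤ C := by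
    intro F _ _ Q hQ p₀
    obtain ⟨C, hC⟩ := ((isCompact_closedBall p₀ 1).prod hK).exists_bound_of_continuousOn
      hQ.continuous.continuousOn
    exact ⟨C, fun p hp a => hC (p, g a) ⟨hp, hgK a⟩⟩
  have meas : ∀ {F : Type u} [NormedAddCommGroup F] [NormedSpace ℝ F] {Q : E × W → F},
      ContDiff ℝ ∞ Q → ∀ p, AEStronglyMeasurable (fun a => c a • Q (p, g a)) μ :=
    fun hQ p => hc.1.smul
      ((hQ.continuous.comp (Continuous.prodMk_right p)).comp_aestronglyMeasurable hg)
  have hasFD : ∀ {F : Type u} [NormedAddCommGroup F] [NormedSpace ℝ F] {Q : E × W → F},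
      ContDiff ℝ ∞ Q → ∀ p₀, HasFDerivAt (fun p => ∫ a, c a • Q (p, g a) ∂μ)
        (∫ a, c a • (fderiv ℝ Q (p₀, g a)).comp (ContinuousLinearMap.inl ℝ E W) ∂μ) p₀ := by
    intro F _ _ Q hQ p₀
    have hQ' : ContDiff ℝ ∞
        (fun q => (fderiv ℝ Q q).comp (ContinuousLinearMap.inl ℝ E W)) :=
      (hQ.fderiv_right (by simp)).clm_comp contDiff_const
    obtain ⟨C₀, hC₀⟩ := key hQ p₀
    obtain ⟨C, hC⟩ := key hQ' p₀
    refine hasFDerivAt_integral_of_dominated_of_fderiv_le (s := Metric.closedBall p₀ 1)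
      (bound := fun a => ‖c a‖ * C)
      (F' := fun p a => c a • (fderiv ℝ Q (p, g a)).comp (ContinuousLinearMap.inl ℝ E W))
      (Metric.closedBall_mem_nhds _ one_pos) (.of_forall (meas hQ)) ?_ (meas hQ' p₀) ?_
      (hc.norm.mul_const C) ?_
    · refine (hc.norm.mul_const C₀).mono' (meas hQ p₀) (.of_forall fun a => ?_)
      rw [norm_smul]
      gcongr
      exact hC₀ p₀ (Metric.mem_closedBall_self zero_le_one) a
    · refine .of_forall fun a p hp => ?_
      rw [norm_smul]
      gcongr
      exact hC p hp a
    · refine .of_forall fun a p _ => HasFDerivAt.const_smul ?_ _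
      exact (hQ.differentiable (by simp) (p, g a)).hasFDerivAt.comp p (hasFDerivAt_prodMk_left p _)
  induction n generalizing F with
  | zero => exact contDiff_zero.2 (continuous_iff_continuousAt.2 fun p => (hasFD hQ p).continuousAt)
  | succ n ih =>
    push_cast
    exact contDiff_succ_iff_hasFDerivAt.2
      ⟨_, ih ((hQ.fderiv_right (by simp)).clm_comp contDiff_const), hasFD hQ⟩

/-- Averages of a smooth function over bounded values of one argument are smooth in the other. -/
theorem contDiff_integral_smul_comp {α W : Type*} {E F : Type u} [MeasurableSpace α]
    {μ : Measure α} [NormedAddCommGroup E] [NormedSpace ℝ E] [FiniteDimensional ℝ E]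
    [NormedAddCommGroup W] [NormedSpace ℝ W] [NormedAddCommGroup F] [NormedSpace ℝ F]
    {Q : E × W → F} (hQ : ContDiff ℝ ∞ Q) {c : α → ℝ} (hc : Integrable c μ)
    {g : α → W} (hg : AEStronglyMeasurable g μ) {K : Set W} (hK : IsCompact K)
    (hgK : ∀ a, g a ∈ K) :
    ContDiff ℝ ∞ (fun p => ∫ a, c a • Q (p, g a) ∂μ) :=
  contDiff_infty.2 fun n => contDiff_nat_integral_smul_comp n hQ hc hg hK hgK

/-! ### Interpolation of polynomial functions on the orthant -/

/-- Functions on `ℝˢ` which are polynomial of degree at most `d` in every variable are recovered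
from finitely many values on the closed orthant, with smooth weights. -/
theorem exists_interpolation (d s : ℕ) :
    ∃ (ι : Type) (_ : Fintype ι) (p : ι → Fin s → ℝ) (w : ι → (Fin s → ℝ) → ℝ),
      (∀ j, 0 ≤ p j) ∧ (∀ j, ContDiff ℝ ∞ (w j)) ∧
      ∀ q : (Fin s → ℝ) → ℝ,
        (∀ lam i, ∃ P : Polynomial ℝ, P.natDegree ≤ d ∧
          ∀ t, q (Function.update lam i t) = P.eval t) →
        ∀ lam, q lam = ∑ j, w j lam * q (p j) := by
  induction s with
  | zero =>
    refine ⟨Unit, inferInstance, fun _ => 0, fun _ _ => 1, fun _ => le_rfl,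
      fun _ => contDiff_const, fun q _ lam => ?_⟩
    simp [Subsingleton.elim lam 0]
  | succ s ih =>
    obtain ⟨ι, _, p, w, hp, hw, h⟩ := ih
    set L : Fin (d + 1) → Polynomial ℝ :=
      fun i => Lagrange.basis Finset.univ (fun i : Fin (d + 1) => ((i : ℕ) : ℝ)) i with hL
    refine ⟨Fin (d + 1) × ι, inferInstance, fun j => Fin.cons ((j.1 : ℕ) : ℝ) (p j.2),
      fun j lam => (L j.1).eval (lam 0) * w j.2 (Fin.tail lam), fun j => ?_, fun j => ?_,
      fun q hq lam => ?_⟩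
    · exact fun i => Fin.cases (by simp) (fun i => by simpa using hp j.2 i) i
    · refine ContDiff.mul (ContDiff.comp (g := fun t => (L j.1).eval t)
        (by simpa using (L j.1).contDiff_aeval (𝕜 := ℝ) ∞) (contDiff_apply ℝ ℝ 0)) ((hw j.2).comp ?_)
      exact contDiff_pi.2 fun i => contDiff_apply ℝ ℝ i.succ
    · obtain ⟨P, hPd, hP⟩ := hq lam 0
      have hcons : ∀ t, q (Fin.cons t (Fin.tail lam)) = P.eval t := fun t => by
        rw [← hP, ← Fin.cons_self_tail lam, Fin.update_cons_zero, Fin.tail_cons]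
      have hinj : Set.InjOn (fun i : Fin (d + 1) => ((i : ℕ) : ℝ)) ((Finset.univ : Finset (Fin (d + 1))) : Set (Fin (d + 1))) :=
        fun i _ j _ hij => Fin.ext (Nat.cast_injective hij)
      have hPL : P = _ := Lagrange.eq_interpolate (f := P) hinj (by
        rw [Finset.card_univ, Fintype.card_fin]
        exact lt_of_le_of_lt Polynomial.degree_le_natDegree
          (by exact_mod_cast Nat.lt_succ_of_le hPd))
      have h1 : q lam = ∑ i : Fin (d + 1),
          q (Fin.cons ((i : ℕ) : ℝ) (Fin.tail lam)) * (L i).eval (lam 0) := by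
        conv_lhs => rw [← Fin.cons_self_tail lam, hcons, hPL]
        simp [Lagrange.interpolate_apply, Polynomial.eval_finsetSum, hcons, hL]
      rw [h1, Fintype.sum_prod_type]
      refine Finset.sum_congr rfl fun i _ => ?_
      rw [h (fun mu => q (Fin.cons ((i : ℕ) : ℝ) mu)) (fun mu k => ?_) (Fin.tail lam),
        Finset.sum_mul]
      · exact Finset.sum_congr rfl fun j _ => by ring
      · obtain ⟨R, hRd, hR⟩ := hq (Fin.cons ((i : ℕ) : ℝ) mu) k.succ
        exact ⟨R, hRd, fun t => by rw [← hR, ← Fin.cons_update]⟩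

/-- The determinant of an affine family of endomorphisms is polynomial in each variable. -/
theorem exists_polynomial_det_add_sum_smul {E : Type*} [NormedAddCommGroup E] [NormedSpace ℝ E]
    [FiniteDimensional ℝ E] {s : ℕ} (H₀ : E →L[ℝ] E) (H : Fin s → E →L[ℝ] E)
    (lam : Fin s → ℝ) (i : Fin s) :
    ∃ P : Polynomial ℝ, P.natDegree ≤ Module.finrank ℝ E ∧
      ∀ t, (H₀ + ∑ j, Function.update lam i t j • H j).det = P.eval t := by
  set b := Module.finBasis ℝ E
  set B : E →L[ℝ] E := H₀ + ∑ j, Function.update lam i 0 j • H j with hB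
  set M := LinearMap.toMatrix b b (B : E →ₗ[ℝ] E)
  set N := LinearMap.toMatrix b b (H i : E →ₗ[ℝ] E)
  refine ⟨_, (Polynomial.natDegree_det_X_add_C_le N M).trans (by simp), fun t => ?_⟩
  have hsum : H₀ + ∑ j, Function.update lam i t j • H j = B + t • H i := by
    rw [hB, add_assoc]
    congr 1
    rw [← Finset.add_sum_erase _ _ (Finset.mem_univ i),
      ← Finset.add_sum_erase (a := i) _ (fun j => Function.update lam i 0 j • H j)
        (Finset.mem_univ i)]
    rw [Finset.sum_congr rfl fun j hj => by
      rw [Function.update_of_ne (Finset.ne_of_mem_erase hj),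
        ← Function.update_of_ne (Finset.ne_of_mem_erase hj) 0 lam]]
    simp [add_comm]
  rw [hsum, ContinuousLinearMap.det, ← LinearMap.det_toMatrix b, ← Polynomial.coe_evalRingHom,
    RingHom.map_det]
  congr 1
  ext j k
  simp [M, N]
  ring

/-! ### Smooth convex potentials of convex bodies -/

section Potential

variable {E : Type*} [NormedAddCommGroup E] [InnerProductSpace ℝ E]

/-- A `C²` convex function `φ` with gradient `G` which differs from the support function of `A`
by a bounded amount. -/
structure IsPotential (φ : E → ℝ) (G : E → E) (A : Set E) : Prop where
  contDiff : ContDiff ℝ 1 G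
  hasFDerivAt : ∀ z, HasFDerivAt φ (innerSL ℝ (G z)) z
  convexOn : ConvexOn ℝ univ φ
  exists_bound : ∃ C, (∀ z, ∀ a ∈ A, inner ℝ a z ≤ φ z + C) ∧ ∀ z, ∃ a ∈ A, φ z ≤ inner ℝ a z + C

namespace IsPotential

variable {φ ψ : E → ℝ} {G G' : E → E} {A B : Set E}

theorem add (h : IsPotential φ G A) (h' : IsPotential ψ G' B) :
    IsPotential (φ + ψ) (G + G') (A + B) where
  contDiff := h.contDiff.add h'.contDiff
  hasFDerivAt z := by simpa using (h.hasFDerivAt z).add (h'.hasFDerivAt z)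
  convexOn := h.convexOn.add h'.convexOn
  exists_bound := by
    obtain ⟨C, h1, h2⟩ := h.exists_bound
    obtain ⟨C', h1', h2'⟩ := h'.exists_bound
    refine ⟨C + C', ?_, fun z => ?_⟩
    · rintro z _ ⟨a, ha, b, hb, rfl⟩
      rw [inner_add_left, Pi.add_apply]
      linarith [h1 z a ha, h1' z b hb]
    · obtain ⟨a, ha, hz⟩ := h2 z
      obtain ⟨b, hb, hz'⟩ := h2' z
      refine ⟨a + b, add_mem_add ha hb, ?_⟩
      rw [inner_add_left, Pi.add_apply]
      linarith

theorem smul (h : IsPotential φ G A) {c : ℝ} (hc : 0 ≤ c) :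
    IsPotential (c • φ) (c • G) (c • A) where
  contDiff := contDiff_const.smul h.contDiff
  hasFDerivAt z := by simpa using (h.hasFDerivAt z).const_smul c
  convexOn := h.convexOn.smul hc
  exists_bound := by
    obtain ⟨C, h1, h2⟩ := h.exists_bound
    refine ⟨c * C, ?_, fun z => ?_⟩
    · rintro z _ ⟨a, ha, rfl⟩
      simp only [real_inner_smul_left, Pi.smul_apply, smul_eq_mul]
      nlinarith [h1 z a ha]
    · obtain ⟨a, ha, hz⟩ := h2 z
      refine ⟨c • a, smul_mem_smul_set ha, ?_⟩
      simp only [real_inner_smul_left, Pi.smul_apply, smul_eq_mul]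
      nlinarith

theorem zero : IsPotential (0 : E → ℝ) 0 (0 : Set E) where
  contDiff := contDiff_const
  hasFDerivAt z := by
    simp only [Pi.zero_apply, map_zero]
    exact hasFDerivAt_const (0 : ℝ) z
  convexOn := convexOn_const 0 convex_univ
  exists_bound := ⟨0, by simp, fun z => ⟨0, by simp⟩⟩

theorem sum {ι : Type*} {φ : ι → E → ℝ} {G : ι → E → E} {A : ι → Set E} (s : Finset ι)
    (h : ∀ i ∈ s, IsPotential (φ i) (G i) (A i)) :
    IsPotential (∑ i ∈ s, φ i) (∑ i ∈ s, G i) (∑ i ∈ s, A i) := by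
  classical
  induction s using Finset.induction_on with
  | empty => simpa using zero
  | insert i s hi ih =>
    rw [Finset.sum_insert hi, Finset.sum_insert hi, Finset.sum_insert hi]
    exact (h i (by simp)).add (ih fun j hj => h j (by simp [hj]))

theorem add_inner_le (h : IsPotential φ G A) (z w : E) : φ z + inner ℝ (G z) (w - z) ≤ φ w := by
  have hconv : ConvexOn ℝ univ (φ ∘ AffineMap.lineMap z w : ℝ → ℝ) := by
    simpa using h.convexOn.comp_affineMap (AffineMap.lineMap z w : ℝ →ᵃ[ℝ] E)
  have hd : HasDerivAt (φ ∘ AffineMap.lineMap z w : ℝ → ℝ) (inner ℝ (G z) (w - z)) 0 := by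
    have := h.hasFDerivAt (AffineMap.lineMap z w (0 : ℝ))
    simpa using this.comp_hasDerivAt (0 : ℝ) AffineMap.hasDerivAt_lineMap
  have := hconv.le_slope_of_hasDerivAt (mem_univ 0) (mem_univ 1) one_pos hd
  simp [slope_def_field] at this
  linarith

theorem inner_sub_nonneg (h : IsPotential φ G A) (z w : E) :
    0 ≤ inner ℝ (G w - G z) (w - z) := by
  have h1 := h.add_inner_le z w
  have h2 := h.add_inner_le w z
  rw [← neg_sub w z, inner_neg_right] at h2
  rw [inner_sub_left]
  linarith

theorem hasFDerivAt_gradient (h : IsPotential φ G A) (z : E) :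
    HasFDerivAt G (fderiv ℝ G z) z :=
  (h.contDiff.differentiable one_ne_zero z).hasFDerivAt

theorem inner_fderiv_nonneg (h : IsPotential φ G A) (z v : E) :
    0 ≤ inner ℝ (fderiv ℝ G z v) v := by
  have hd : HasDerivAt (fun t : ℝ => inner ℝ (G (z + t • v)) v) (inner ℝ (fderiv ℝ G z v) v) 0 := by
    have h1 : HasDerivAt (fun t : ℝ => z + t • v) v 0 := by
      simpa using ((hasDerivAt_id (0 : ℝ)).smul_const v).const_add z
    have h2 := HasFDerivAt.comp_hasDerivAt (0 : ℝ) (f := fun t : ℝ => z + t • v)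
      (by simpa using h.hasFDerivAt_gradient z) h1
    simpa using h2.inner ℝ (hasDerivAt_const (0 : ℝ) v)
  have hmono : Monotone (fun t : ℝ => inner ℝ (G (z + t • v)) v) := by
    intro s t hst
    rcases hst.eq_or_lt with rfl | hst
    · exact le_rfl
    have := h.inner_sub_nonneg (z + s • v) (z + t • v)
    rw [add_sub_add_left_eq_sub, ← sub_smul, real_inner_smul_right, inner_sub_left] at this
    have := (mul_nonneg_iff_of_pos_left (sub_pos.2 hst)).1 this
    simpa using this
  exact hd.deriv ▸ hmono.deriv_nonneg

theorem gradient_eq_of_forall_le (h : IsPotential φ G A) {p z : E}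
    (hz : ∀ y, φ z - inner ℝ p z ≤ φ y - inner ℝ p y) : G z = p := by
  have hloc : IsLocalMin (φ - ⇑(innerSL ℝ p)) z := .of_forall fun y => by simpa using hz y
  have hzero := hloc.hasFDerivAt_eq_zero ((h.hasFDerivAt z).sub (innerSL ℝ p).hasFDerivAt)
  exact ext_inner_right ℝ fun v => by simpa using DFunLike.congr_fun (sub_eq_zero.1 hzero) v

/-- The gradient of a potential is injective off its critical points, since it is constant on
segments whose endpoints it identifies. -/
theorem injOn_gradient [FiniteDimensional ℝ E] (h : IsPotential φ G A) :
    InjOn G {z | (fderiv ℝ G z).det ≠ 0} := by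
  intro z hz w _ hzw
  by_contra hne
  have hconst : ∀ t ∈ Icc (0 : ℝ) 1, G (z + t • (w - z)) = G z := by
    intro t ht
    set u := z + t • (w - z) with hu
    have hmin : ∀ y, φ u - inner ℝ (G z) u ≤ φ y - inner ℝ (G z) y := by
      intro y
      have h1 := h.add_inner_le z y
      have h2 : φ w ≤ φ z + inner ℝ (G z) (w - z) := by
        have := h.add_inner_le w z
        rw [← hzw, ← neg_sub w z, inner_neg_right] at this
        linarith
      have h3 : φ u ≤ (1 - t) * φ z + t * φ w := by
        have := h.convexOn.2 (mem_univ z) (mem_univ w) (sub_nonneg.2 ht.2) ht.1 (by ring)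
        rwa [show (1 - t) • z + t • w = u by rw [hu]; module] at this
      have h4 : inner ℝ (G z) u = inner ℝ (G z) z + t * inner ℝ (G z) (w - z) := by
        rw [hu, inner_add_right, real_inner_smul_right]
      rw [inner_sub_right] at h1
      nlinarith [ht.1]
    exact h.gradient_eq_of_forall_le hmin
  have hd : HasDerivWithinAt (fun t : ℝ => G (z + t • (w - z))) (fderiv ℝ G z (w - z))
      (Icc 0 1) 0 := by
    have h1 : HasDerivAt (fun t : ℝ => z + t • (w - z)) (w - z) 0 := by
      simpa using ((hasDerivAt_id (0 : ℝ)).smul_const (w - z)).const_add z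
    exact (HasFDerivAt.comp_hasDerivAt (0 : ℝ) (f := fun t : ℝ => z + t • (w - z))
      (by simpa using h.hasFDerivAt_gradient z) h1).hasDerivWithinAt
  have hd' : HasDerivWithinAt (fun t : ℝ => G (z + t • (w - z))) 0 (Icc 0 1) 0 :=
    (hasDerivWithinAt_const 0 _ (G z)).congr hconst (hconst 0 (by simp))
  have hzero := (uniqueDiffOn_Icc zero_lt_one 0 (by simp)).eq_deriv _ hd hd'
  refine hz (by_contra fun hdet => ?_)
  have hker := LinearMap.ker_eq_bot.1 ((LinearMap.isUnit_iff_ker_eq_bot _).1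
    ((LinearMap.isUnit_iff_isUnit_det (fderiv ℝ G z : E →ₗ[ℝ] E)).2 (isUnit_iff_ne_zero.2 hdet)))
  exact hne (sub_eq_zero.1 (hker (by simpa using hzero))).symm

theorem gradient_mem (h : IsPotential φ G A) [CompleteSpace E] (hA : Convex ℝ A)
    (hAc : IsCompact A) (z : E) : G z ∈ A := by
  by_contra hz
  obtain ⟨f, u, hfz, hf⟩ := geometric_hahn_banach_point_closed hA hAc.isClosed hz
  obtain ⟨C, -, hC⟩ := h.exists_bound
  obtain ⟨R, hR⟩ := hAc.isBounded.exists_norm_le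
  set w := (InnerProductSpace.toDual ℝ E).symm f with hw
  have hfw : ∀ y, inner ℝ y w = f y := fun y => by
    rw [real_inner_comm]; exact InnerProductSpace.toDual_symm_apply
  have key : ∀ t : ℝ, 0 ≤ t → t * (u - f (G z)) ≤ R * ‖z‖ + C - φ z := by
    intro t ht
    have h1 := h.add_inner_le z (z - t • w)
    obtain ⟨a, ha, h2⟩ := hC (z - t • w)
    have h3 : inner ℝ a z ≤ R * ‖z‖ :=
      (real_inner_le_norm a z).trans (mul_le_mul_of_nonneg_right (hR a ha) (norm_nonneg z))
    rw [inner_sub_right, real_inner_smul_right, hfw] at h2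
    rw [sub_sub_cancel_left, inner_neg_right, real_inner_smul_right, hfw] at h1
    nlinarith [hf a ha]
  have hpos : 0 < u - f (G z) := sub_pos.2 hfz
  have := key ((|R * ‖z‖ + C - φ z| + 1) / (u - f (G z))) (by positivity)
  rw [div_mul_cancel₀ _ hpos.ne'] at this
  linarith [le_abs_self (R * ‖z‖ + C - φ z)]

theorem interior_subset_range [FiniteDimensional ℝ E] (h : IsPotential φ G A) :
    interior A ⊆ range G := by
  intro p hp
  obtain ⟨ε, hε, hball⟩ := Metric.nhds_basis_closedBall.mem_iff.1 (mem_interior_iff_mem_nhds.1 hp)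
  obtain ⟨C, hC, -⟩ := h.exists_bound
  have hcont : Continuous φ := continuous_iff_continuousAt.2 fun z => (h.hasFDerivAt z).continuousAt
  have hlow : ∀ z, ε * ‖z‖ - C ≤ φ z - inner ℝ p z := by
    intro z
    have hmem : p + (ε * ‖z‖⁻¹) • z ∈ A := hball (by
      rw [mem_closedBall_iff_norm, add_sub_cancel_left, norm_smul, norm_mul, norm_inv, norm_norm,
        Real.norm_of_nonneg hε.le, mul_assoc]
      exact mul_le_of_le_one_right hε.le inv_mul_le_one)
    have := hC z _ hmem
    rw [inner_add_left, real_inner_smul_left, real_inner_self_eq_norm_sq] at this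
    have h2 : ε * ‖z‖⁻¹ * ‖z‖ ^ 2 = ε * ‖z‖ := by
      rcases eq_or_ne ‖z‖ 0 with h0 | h0
      · simp [h0]
      · field_simp
    linarith
  have htend : Tendsto (fun z => φ z - inner ℝ p z) (cocompact E) atTop :=
    tendsto_atTop_mono hlow (tendsto_atTop_add_const_right _ (-C)
      ((tendsto_norm_cocompact_atTop (E := E)).const_mul_atTop hε))
  obtain ⟨z, hz⟩ := Continuous.exists_forall_le (by fun_prop) htend
  exact ⟨z, h.gradient_eq_of_forall_le hz⟩

end IsPotential

/-- A (not necessarily symmetric) endomorphism with nonnegative quadratic form has nonnegative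
determinant. -/
theorem ContinuousLinearMap.det_nonneg_of_inner_nonneg [FiniteDimensional ℝ E] (T : E →L[ℝ] E)
    (hT : ∀ v, 0 ≤ inner ℝ (T v) v) : 0 ≤ T.det := by
  by_contra! hneg
  set D : ℝ → ℝ := fun t => ((1 - t) • T + t • ContinuousLinearMap.id ℝ E).det with hD
  have hcont : Continuous D := ContinuousLinearMap.continuous_det.comp (by fun_prop)
  have h0 : D 0 ≤ 0 := by simpa [hD] using hneg.le
  have h1 : 0 ≤ D 1 := by simp [hD, ContinuousLinearMap.det]
  obtain ⟨t, ht, htD⟩ := intermediate_value_Icc zero_le_one hcont.continuousOn ⟨h0, h1⟩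
  have ht0 : 0 < t := ht.1.lt_of_ne (by rintro rfl; exact hneg.ne (by simpa [hD] using htD))
  obtain ⟨v, hv, hv0⟩ := (Submodule.ne_bot_iff _).1 (LinearMap.bot_lt_ker_of_det_eq_zero htD).ne'
  have hker : (1 - t) • T v + t • v = 0 := by simpa using hv
  have hinner : (1 - t) * inner ℝ (T v) v + t * inner ℝ v v = 0 := by
    rw [← real_inner_smul_left, ← real_inner_smul_left, ← inner_add_left, hker, inner_zero_left]
  have hvv : 0 < t * inner ℝ v v := mul_pos ht0 (real_inner_self_pos.2 hv0)
  linarith [mul_nonneg (sub_nonneg.2 ht.2) (hT v)]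

namespace IsPotential

variable {φ : E → ℝ} {G : E → E} {A : Set E} {F : Type*} [NormedAddCommGroup F]
  [NormedSpace ℝ F]

theorem det_nonneg [FiniteDimensional ℝ E] (h : IsPotential φ G A) (z : E) : 0 ≤ (fderiv ℝ G z).det :=
  ContinuousLinearMap.det_nonneg_of_inner_nonneg _ (h.inner_fderiv_nonneg z)

variable [MeasurableSpace E] [BorelSpace E]

theorem measurableSet_det_ne_zero (h : IsPotential φ G A) :
    MeasurableSet {z | (fderiv ℝ G z).det ≠ 0} :=
  (isOpen_ne_fun (ContinuousLinearMap.continuous_det.comp (h.contDiff.continuous_fderiv one_ne_zero))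
    continuous_const).measurableSet

variable [FiniteDimensional ℝ E]

/-- The gradient of a potential maps onto the convex body up to a null set. -/
theorem image_ae_eq (h : IsPotential φ G A) (μ : Measure E) [μ.IsAddHaarMeasure]
    (hA : Convex ℝ A) (hAc : IsCompact A) :
    G '' {z | (fderiv ℝ G z).det ≠ 0} =ᵐ[μ] A := by
  refine (LE.le.eventuallyLE ?_).antisymm (ae_le_set.2 ?_)
  · rintro _ ⟨z, -, rfl⟩
    exact h.gradient_mem hA hAc z
  · refine measure_mono_null (t := frontier A ∪ G '' {z | (fderiv ℝ G z).det = 0}) ?_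
      (measure_union_null (hA.addHaar_frontier μ)
        (addHaar_image_eq_zero_of_det_fderivWithin_eq_zero μ
          (fun z _ => (h.hasFDerivAt_gradient z).hasFDerivWithinAt) fun z hz => hz))
    rintro p ⟨hp, hp'⟩
    by_cases hint : p ∈ interior A
    · obtain ⟨z, rfl⟩ := h.interior_subset_range hint
      exact .inr ⟨z, by_contra fun hz => hp' ⟨z, hz, rfl⟩, rfl⟩
    · exact .inl ⟨subset_closure hp, hint⟩

theorem setIntegral_eq (h : IsPotential φ G A) (μ : Measure E) [μ.IsAddHaarMeasure]
    (hA : Convex ℝ A) (hAc : IsCompact A) (f : E → F) :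
    ∫ y in A, f y ∂μ = ∫ z, (fderiv ℝ G z).det • f (G z) ∂μ := by
  rw [← setIntegral_congr_set (h.image_ae_eq μ hA hAc),
    integral_image_eq_integral_abs_det_fderiv_smul μ h.measurableSet_det_ne_zero
      (fun z _ => (h.hasFDerivAt_gradient z).hasFDerivWithinAt) h.injOn_gradient]
  simp_rw [abs_of_nonneg (h.det_nonneg _)]
  refine setIntegral_eq_integral_of_forall_compl_eq_zero fun z hz => ?_
  rw [not_not.1 hz, zero_smul]

theorem integrable_det (h : IsPotential φ G A) (μ : Measure E) [μ.IsAddHaarMeasure]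
    (hA : Convex ℝ A) (hAc : IsCompact A) :
    Integrable (fun z => (fderiv ℝ G z).det) μ := by
  have h1 : IntegrableOn (fun _ => (1 : ℝ)) (G '' {z | (fderiv ℝ G z).det ≠ 0}) μ :=
    (integrableOn_const hAc.measure_ne_top).congr_set_ae (h.image_ae_eq μ hA hAc)
  rw [integrableOn_image_iff_integrableOn_abs_det_fderiv_smul μ h.measurableSet_det_ne_zero
      (fun z _ => (h.hasFDerivAt_gradient z).hasFDerivWithinAt) h.injOn_gradient] at h1
  simp_rw [abs_of_nonneg (h.det_nonneg _), smul_eq_mul, mul_one] at h1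
  exact (integrableOn_iff_integrable_of_support_subset fun z hz => hz).1 h1

end IsPotential

/-- Every nonempty compact set has a potential: mollify its support function. -/
theorem exists_isPotential [FiniteDimensional ℝ E] [MeasurableSpace E] [BorelSpace E] {A : Set E}
    (hA : IsCompact A) (hne : A.Nonempty) : ∃ φ G, IsPotential φ G A := by
  obtain ⟨R, hR⟩ := hA.isBounded.exists_norm_le
  have hmax : ∀ z, ∃ a ∈ A, ∀ b ∈ A, inner ℝ b z ≤ inner ℝ a z := fun z =>
    hA.exists_isMaxOn hne (f := fun a => inner ℝ a z) (by fun_prop)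
  choose σ hσA hσ using hmax
  set h : E → ℝ := fun z => inner ℝ (σ z) z with hh
  have hR0 : 0 ≤ R := (norm_nonneg _).trans (hR _ (hσA 0))
  have hdist : ∀ z w, h z - h w ≤ R * ‖z - w‖ := by
    intro z w
    have h1 : h z - h w ≤ inner ℝ (σ z) (z - w) := by
      rw [inner_sub_right]
      linarith [hσ w _ (hσA z)]
    exact h1.trans ((real_inner_le_norm _ _).trans (by gcongr; exact hR _ (hσA z)))
  have hlip : LipschitzWith R.toNNReal h := .of_dist_le_mul fun z w => by
    rw [Real.coe_toNNReal _ hR0, Real.dist_eq, dist_eq_norm, abs_le]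
    have := hdist w z
    rw [norm_sub_rev] at this
    exact ⟨by linarith, hdist z w⟩
  have hconv : ConvexOn ℝ univ h := by
    refine ⟨convex_univ, fun z _ w _ a b ha hb _ => ?_⟩
    simp only [hh, inner_add_right, real_inner_smul_right, smul_eq_mul]
    gcongr
    · exact hσ z _ (hσA _)
    · exact hσ w _ (hσA _)
  let ρ : ContDiffBump (0 : E) := default
  set μ : Measure E := volume
  set φ : E → ℝ := convolution (ρ.normed μ) h (ContinuousLinearMap.lsmul ℝ ℝ) μ with hφ
  have hsmooth : ContDiff ℝ 2 φ := ρ.hasCompactSupport_normed.contDiff_convolution_left _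
    ρ.contDiff_normed hlip.continuous.locallyIntegrable
  have hclose : ∀ z, dist (φ z) (h z) ≤ R * ρ.rOut := fun z =>
    ρ.dist_normed_convolution_le hlip.continuous.aestronglyMeasurable fun w hw =>
      (hlip.dist_le_mul w z).trans (by
        rw [Real.coe_toNNReal _ hR0]
        gcongr
        exact (Metric.mem_ball.1 hw).le)
  refine ⟨φ, gradient φ, ?_, ?_, ?_, R * ρ.rOut, ?_, ?_⟩
  · exact (InnerProductSpace.toDual ℝ E).symm.contDiff.comp (hsmooth.fderiv_right le_rfl)
  · intro z
    exact ((hsmooth.differentiable two_ne_zero) z).hasGradientAt.hasFDerivAt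
  · have hint : ∀ z, Integrable (fun y => ρ.normed μ y * h (z - y)) μ := fun z =>
      (Continuous.mul ρ.continuous_normed (by have := hlip.continuous; fun_prop)
        ).integrable_of_hasCompactSupport ρ.hasCompactSupport_normed.mul_right
    have hφz : ∀ z, φ z = ∫ y, ρ.normed μ y * h (z - y) ∂μ := fun z => rfl
    refine ⟨convex_univ, fun z _ w _ a b ha hb hab => ?_⟩
    rw [hφz, hφz, hφz, smul_eq_mul, smul_eq_mul, ← integral_const_mul, ← integral_const_mul,
      ← integral_add ((hint z).const_mul a) ((hint w).const_mul b)]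
    refine integral_mono (hint _) (((hint z).const_mul a).add ((hint w).const_mul b)) fun y => ?_
    have h1 := hconv.2 (mem_univ (z - y)) (mem_univ (w - y)) ha hb hab
    have h2 : a • (z - y) + b • (w - y) = a • z + b • w - y := by
      rw [smul_sub, smul_sub, sub_add_sub_comm, ← add_smul, hab, one_smul]
    rw [h2, smul_eq_mul, smul_eq_mul] at h1
    have := mul_le_mul_of_nonneg_left h1 (ρ.nonneg_normed (μ := μ) y)
    linarith
  · intro z a ha
    have := (abs_le.1 (hclose z)).1
    linarith [hσ z a ha]
  · intro z
    have := (abs_le.1 (hclose z)).2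
    exact ⟨σ z, hσA z, by simp only [hh] at this; linarith⟩

end Potential

/-! ### Smoothness of integrals over Minkowski sums -/

section MinkowskiSum

variable {E : Type*} [NormedAddCommGroup E] [NormedSpace ℝ E] {ι : Type*} [Fintype ι]
  {K : Set E} {A : ι → Set E}

theorem Convex.add_sum_smul (hK : Convex ℝ K) (hA : ∀ i, Convex ℝ (A i)) (lam : ι → ℝ) :
    Convex ℝ (K + ∑ i, lam i • A i) :=
  hK.add (Finset.sum_induction _ (Convex ℝ) (fun _ _ h h' => h.add h') (convex_singleton 0)
    fun i _ => (hA i).smul (lam i))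

theorem IsCompact.add_sum_smul (hK : IsCompact K) (hA : ∀ i, IsCompact (A i)) (lam : ι → ℝ) :
    IsCompact (K + ∑ i, lam i • A i) :=
  hK.add (Finset.sum_induction _ IsCompact (fun _ _ h h' => h.add h') isCompact_singleton
    fun i _ => (hA i).smul (lam i))

end MinkowskiSum

/-- The integral of a smooth function over `K + ∑ λᵢ Aᵢ` extends from the closed orthant to a smooth
function of `λ` and of any parameters. -/
theorem exists_contDiff_eq_setIntegral_add_sum_smul {E : Type*} [NormedAddCommGroup E]
    [InnerProductSpace ℝ E] [FiniteDimensional ℝ E] [MeasurableSpace E] [BorelSpace E]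
    (μ : Measure E) [μ.IsAddHaarMeasure] {P F : Type} [NormedAddCommGroup P] [NormedSpace ℝ P]
    [FiniteDimensional ℝ P] [NormedAddCommGroup F] [NormedSpace ℝ F] {s : ℕ}
    {K : Set E} (hK : Convex ℝ K) (hKc : IsCompact K) (hKne : K.Nonempty)
    {A : Fin s → Set E} (hA : ∀ i, Convex ℝ (A i)) (hAc : ∀ i, IsCompact (A i))
    (hAne : ∀ i, (A i).Nonempty) {Ψ : P × E → F} (hΨ : ContDiff ℝ ∞ Ψ) :
    ∃ Θ : P × (Fin s → ℝ) → F, ContDiff ℝ ∞ Θ ∧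
      ∀ p lam, 0 ≤ lam → ∫ y in K + ∑ i, lam i • A i, Ψ (p, y) ∂μ = Θ (p, lam) := by
  obtain ⟨φ₀, G₀, h₀⟩ := exists_isPotential hKc hKne
  choose φ G h using fun i => exists_isPotential (hAc i) (hAne i)
  obtain ⟨κ, _, pt, w, hpt, hw, hinterp⟩ := exists_interpolation (Module.finrank ℝ E) s
  set D : (Fin s → ℝ) → E → ℝ :=
    fun lam z => (fderiv ℝ G₀ z + ∑ i, lam i • fderiv ℝ (G i) z).det with hD
  set g : E → E × (Fin s → E) := fun z => (G₀ z, fun i => G i z) with hg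
  set Q : (P × (Fin s → ℝ)) × (E × (Fin s → E)) → F :=
    fun q => Ψ (q.1.1, q.2.1 + ∑ i, q.1.2 i • q.2.2 i) with hQ
  have hQs : ContDiff ℝ ∞ Q := hΨ.comp (by fun_prop)
  have hpot : ∀ lam : Fin s → ℝ, 0 ≤ lam →
      IsPotential (φ₀ + ∑ i, lam i • φ i) (G₀ + ∑ i, lam i • G i) (K + ∑ i, lam i • A i) :=
    fun lam hlam => h₀.add (IsPotential.sum _ fun i _ => (h i).smul (hlam i))
  have hfd : ∀ lam z, (fderiv ℝ (G₀ + ∑ i, lam i • G i) z).det = D lam z := fun lam z => by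
    have : HasFDerivAt (G₀ + ∑ i, lam i • G i) (fderiv ℝ G₀ z + ∑ i, lam i • fderiv ℝ (G i) z) z :=
      (h₀.hasFDerivAt_gradient z).add
        (HasFDerivAt.sum fun i _ => ((h i).hasFDerivAt_gradient z).const_smul (lam i))
    rw [this.fderiv]
  have hDint : ∀ j, Integrable (D (pt j)) μ := fun j => by
    have := (hpot _ (hpt j)).integrable_det μ (hK.add_sum_smul hA _) (hKc.add_sum_smul hAc _)
    simpa only [hfd] using this
  have hgc : Continuous g :=
    h₀.contDiff.continuous.prodMk (continuous_pi fun i => (h i).contDiff.continuous)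
  have hcomp : IsCompact (K ×ˢ Set.pi univ A) := hKc.prod (isCompact_univ_pi hAc)
  have hgmem : ∀ z, g z ∈ K ×ˢ Set.pi univ A := fun z =>
    ⟨h₀.gradient_mem hK hKc z, fun i _ => (h i).gradient_mem (hA i) (hAc i) z⟩
  refine ⟨fun q => ∑ j, w j q.2 • ∫ z, D (pt j) z • Q (q, g z) ∂μ, ?_, fun p lam hlam => ?_⟩
  · exact ContDiff.sum fun j _ => ((hw j).comp contDiff_snd).smul
      (contDiff_integral_smul_comp hQs (hDint j) hgc.aestronglyMeasurable hcomp hgmem)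
  · rw [(hpot lam hlam).setIntegral_eq μ (hK.add_sum_smul hA _) (hKc.add_sum_smul hAc _)]
    obtain ⟨C, hC⟩ := hcomp.exists_bound_of_continuousOn (f := fun v => Q ((p, lam), v))
      (hQs.continuous.comp (Continuous.prodMk_right _)).continuousOn
    have hint : ∀ j, Integrable (fun z => D (pt j) z • Q ((p, lam), g z)) μ := fun j =>
      ((hDint j).norm.mul_const C).mono' ((hDint j).1.smul
        ((hQs.continuous.comp (Continuous.prodMk_right _)).comp hgc).aestronglyMeasurable)
        (.of_forall fun z => by
          rw [norm_smul]
          gcongr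
          exact hC _ (hgmem z))
    simp_rw [← integral_smul]
    rw [← integral_finsetSum (f := fun j z => w j lam • D (pt j) z • Q ((p, lam), g z)) _
      fun j _ => (hint j).smul (w j lam)]
    refine integral_congr_ae (.of_forall fun z => ?_)
    have := hinterp (fun lam => D lam z)
      (fun lam i => exists_polynomial_det_add_sum_smul _ (fun i => fderiv ℝ (G i) z) lam i) lam
    simp only [hfd, this, Finset.sum_smul, mul_smul]
    simp [hQ, hg]

theorem setIntegral_singleton_add_smul {E F : Type*} [NormedAddCommGroup E] [NormedSpace ℝ E]
    [FiniteDimensional ℝ E] [MeasurableSpace E] [BorelSpace E] (μ : Measure E)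
    [μ.IsAddHaarMeasure] [NormedAddCommGroup F] [NormedSpace ℝ F] (f : E → F) (x : E) {r : ℝ}
    (hr : 0 < r) (S : Set E) :
    ∫ y in {x} + r • S, f y ∂μ = r ^ Module.finrank ℝ E • ∫ y in S, f (x + r • y) ∂μ := by
  rw [Measure.setIntegral_comp_smul_of_pos μ (fun y => f (x + y)) S hr,
    smul_inv_smul₀ (pow_pos hr _).ne', singleton_add,
    (measurePreserving_add_left μ x).setIntegral_image_emb (measurableEmbedding_addLeft x)]

theorem scaleTrans_add_sum_smul {n s : ℕ} {r : ℝ} (hr : r ≠ 0) (x : Euc n)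
    (K : ConvexBody (Euc n)) (A : Fin s → ConvexBody (Euc n)) (lam : Fin s → ℝ) :
    (scaleTrans r x K : Set (Euc n)) + ∑ i, lam i • (A i : Set (Euc n)) =
      {x} + r • ((K : Set (Euc n)) + ∑ i, (r⁻¹ • lam) i • (A i : Set (Euc n))) := by
  have hx : (ptBody x : Set (Euc n)) = {x} := rfl
  rw [scaleTrans, ConvexBody.coe_add, ConvexBody.coe_smul, hx, smul_add, Finset.smul_sum,
    add_comm (r • (K : Set (Euc n))), add_assoc]
  simp only [Pi.smul_apply, smul_eq_mul, smul_smul, mul_inv_cancel_left₀ hr]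

/-- As `r → 0⁺`,
`r^{-k} ∂^{n-k}/∂λ |₀ ∫_{rK + x + Σ λᵢAᵢ} f  →  f(x) · ∂^{n-k}/∂λ |₀ vol(K + Σ λᵢAᵢ)`. -/
theorem leading_term_of_mixed_derivative_valuation {n : ℕ} (hn : 1 ≤ n)
    (k : ℕ) (hk : k ≤ n) (f : Euc n → ℂ) (hf : ContDiff ℝ ∞ f)
    (A : Fin (n - k) → ConvexBody (Euc n)) (K : ConvexBody (Euc n)) (x : Euc n) :
    Filter.Tendsto
      (fun r : ℝ => ((r : ℂ) ^ k)⁻¹ * mixedPartialAtZero (fun lam : Fin (n - k) → ℝ =>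
        ∫ y in ((scaleTrans r x K : Set (Euc n)) + ∑ i, lam i • (A i : Set (Euc n))), f y))
      (nhdsWithin 0 (Set.Ioi 0))
      (nhds (f x * ((mixedPartialAtZero (fun lam : Fin (n - k) → ℝ =>
        (volume ((K : Set (Euc n)) + ∑ i, lam i • (A i : Set (Euc n)))).toReal) : ℝ) : ℂ))) := by
  have hfs : ContDiff ℝ ∞ (fun q : ℝ × Euc n => f (x + q.1 • q.2)) := hf.comp (by fun_prop)
  have hAc := fun i => (A i).isCompact
  obtain ⟨Ψ, hΨ, hΨeq⟩ := exists_contDiff_eq_setIntegral_add_sum_smul volume K.convex K.isCompact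
    K.nonempty (fun i => (A i).convex) hAc (fun i => (A i).nonempty) hfs
  obtain ⟨V, hV, hVeq⟩ := exists_contDiff_eq_setIntegral_add_sum_smul (P := ℝ) volume K.convex
    K.isCompact K.nonempty (fun i => (A i).convex) hAc (fun i => (A i).nonempty)
    (contDiff_const (c := (1 : ℝ)))
  obtain ⟨Θ, hΘ, hΘeq⟩ := exists_contDiff_foldl_pderivOrth (List.finRange (n - k)) Ψ hΨ
  obtain ⟨Υ, -, hΥeq⟩ := exists_contDiff_foldl_pderivOrth (List.finRange (n - k)) V hV
  have hvol : ∀ lam : Fin (n - k) → ℝ, 0 ≤ lam →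
      (volume ((K : Set (Euc n)) + ∑ i, lam i • (A i : Set (Euc n)))).toReal = V (0, lam) := by
    intro lam hlam
    rw [← hVeq 0 lam hlam]
    simp [Measure.real]
  have hVmixed : mixedPartialAtZero (fun lam : Fin (n - k) → ℝ =>
      (volume ((K : Set (Euc n)) + ∑ i, lam i • (A i : Set (Euc n)))).toReal) = Υ (0, 0) := by
    have := hΥeq (.id ℝ ℝ) 0 1 _ (fun lam hlam => by simpa using hvol lam hlam) 0 le_rfl
    simpa [mixedPartialAtZero] using this
  have hzero : Θ (0, 0) = f x * (Υ (0, 0) : ℂ) := by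
    set T : ℝ →L[ℝ] ℂ := (f x) • Complex.ofRealCLM with hT
    have h1 : ∀ lam : Fin (n - k) → ℝ, 0 ≤ lam → Ψ (0, lam) = T (V (0, lam)) := by
      intro lam hlam
      rw [← hΨeq 0 lam hlam, ← hVeq 0 lam hlam]
      simp [hT, mul_comm]
    have h2 := hΘeq (.id ℝ ℂ) 0 1 (fun lam => Ψ (0, lam)) (fun lam _ => by simp) 0 le_rfl
    have h3 := hΥeq T 0 1 (fun lam => Ψ (0, lam)) (fun lam hlam => by simpa using h1 lam hlam) 0
      le_rfl
    simpa [hT] using h2.symm.trans h3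
  have hr : ∀ r : ℝ, 0 < r → ((r : ℂ) ^ k)⁻¹ * mixedPartialAtZero (fun lam : Fin (n - k) → ℝ =>
      ∫ y in ((scaleTrans r x K : Set (Euc n)) + ∑ i, lam i • (A i : Set (Euc n))), f y)
      = Θ (r, 0) := by
    intro r hr
    have h1 := hΘeq (r ^ n • .id ℝ ℂ) r r⁻¹ (fun lam : Fin (n - k) → ℝ =>
      ∫ y in ((scaleTrans r x K : Set (Euc n)) + ∑ i, lam i • (A i : Set (Euc n))), f y)
      (fun lam hlam => by
        rw [scaleTrans_add_sum_smul hr.ne', setIntegral_singleton_add_smul _ _ _ hr,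
          hΨeq r (r⁻¹ • lam) (smul_nonneg (inv_nonneg.2 hr.le) hlam)]
        simp) 0 le_rfl
    have hrn : (r : ℂ) ^ n = (r : ℂ) ^ k * (r : ℂ) ^ (n - k) := by
      rw [← pow_add, Nat.add_sub_cancel' hk]
    have hr0 : (r : ℂ) ≠ 0 := by exact_mod_cast hr.ne'
    rw [mixedPartialAtZero, h1]
    simp only [List.length_finRange, smul_zero, smul_apply, ContinuousLinearMap.id_apply,
      Complex.real_smul, Complex.ofReal_pow, Complex.ofReal_inv, hrn, inv_pow]
    field_simp
  rw [hVmixed, ← hzero]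
  have hlim : Tendsto (fun r : ℝ => Θ (r, 0)) (𝓝[>] 0) (𝓝 (Θ (0, 0))) :=
    ((hΘ.continuous.comp (Continuous.prodMk_left 0)).tendsto 0).mono_left nhdsWithin_le_nhds
  refine hlim.congr' ?_
  filter_upwards [self_mem_nhdsWithin] with r hrpos
  exact (hr r hrpos).symm
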